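/- For every α ∈ (0,1) and every S > 0, with ᾱ = 1−α: H_b(α) − (2√(π·α·ᾱ)/ln 2)·S^{−1/2}·e^{−S/4} ≤ Ĩ(α,S) ≤ H_b(α) − (2√(π·α·ᾱ)/ln 2)·S^{−1/2}·e^{−S/4} + (√(π·α·ᾱ)·(π² + 8 + (ln(α/ᾱ))²)/(2·ln 2))·S^{−3/2}·e^{−S/4}. In particular, Ĩ(α,S) = H_b(α) − (2√(π·α·ᾱ)/ln 2)·S^{−1/2}·e^{−S/4}·(1 + o(1)) as S → ∞. -/

import Mathlib

open MeasureTheory ProbabilityTheory Real Filter Asymptotics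

/-- Binary entropy function (in bits). -/
noncomputable def binEnt (p : ℝ) : ℝ :=
  -(p * Real.logb 2 p) - (1 - p) * Real.logb 2 (1 - p)

/-- `Ĩ(α, S)`: the mutual information of the binary-input additive Gaussian channel with
additive SNR `S`, a priori probabilities `α, 1-α`, and `W ~ N(0, 2S)`:
`Ĩ(α,S) = H_b(α) − α·E[log₂(1 + ((1-α)/α)·e^{W−S})] − (1-α)·E[log₂(1 + (α/(1-α))·e^{W−S})]`. -/
noncomputable def Itilde (α S : ℝ) : ℝ :=
  binEnt α
    - α * ∫ w, Real.logb 2 (1 + ((1 - α) / α) * Real.exp (w - S))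
        ∂(gaussianReal 0 (2 * S).toNNReal)
    - (1 - α) * ∫ w, Real.logb 2 (1 + (α / (1 - α)) * Real.exp (w - S))
        ∂(gaussianReal 0 (2 * S).toNNReal)

noncomputable def gI (v : ℝ) : ℝ := Real.log (1 + Real.exp v) * Real.exp (-v / 2)

noncomputable def kI (v : ℝ) : ℝ := Real.exp (v / 2) / (1 + Real.exp v)

lemma gI_cont : Continuous gI := by
  unfold gI
  refine Continuous.mul (Continuous.log (by fun_prop) (fun x => ?_)) (by fun_prop)
  positivity

lemma kI_cont : Continuous kI := by
  unfold kI
  refine Continuous.div (by fun_prop) (by fun_prop) (fun x => ?_)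
  positivity

lemma gI_nonneg (v : ℝ) : 0 ≤ gI v := by
  unfold gI
  have : 0 ≤ Real.log (1 + Real.exp v) := Real.log_nonneg (by linarith [Real.exp_pos v])
  positivity

lemma kI_nonneg (v : ℝ) : 0 ≤ kI v := by
  unfold kI; positivity

lemma kI_neg (v : ℝ) : kI (-v) = kI v := by
  unfold kI
  rw [div_eq_div_iff (by positivity) (by positivity), mul_add, mul_add, ← Real.exp_add,
    ← Real.exp_add]
  ring_nf

lemma kI_le (v : ℝ) : kI v ≤ Real.exp (-|v| / 2) := by
  have key : ∀ w : ℝ, 0 ≤ w → kI w ≤ Real.exp (-w / 2) := by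
    intro w hw
    unfold kI
    rw [div_le_iff₀ (by positivity), mul_add, ← Real.exp_add]
    have : -w / 2 + w = w / 2 := by ring
    rw [this]
    linarith [Real.exp_pos (-w / 2)]
  rcases le_total 0 v with h | h
  · rw [abs_of_nonneg h]; exact key v h
  · rw [abs_of_nonpos h, ← kI_neg]; exact key (-v) (by linarith)

lemma gI_le (v : ℝ) : gI v ≤ (1 + |v|) * Real.exp (-|v| / 2) := by
  unfold gI
  rcases le_total 0 v with h | h
  · rw [abs_of_nonneg h]
    refine mul_le_mul_of_nonneg_right ?_ (Real.exp_pos _).le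
    rw [Real.log_le_iff_le_exp (by positivity), Real.exp_add]
    have h1 : 1 ≤ Real.exp v := Real.one_le_exp h
    have h2 : (2 : ℝ) ≤ Real.exp 1 := by linarith [Real.add_one_le_exp (1 : ℝ)]
    nlinarith
  · rw [abs_of_nonpos h]
    have h1 : Real.log (1 + Real.exp v) ≤ Real.exp v := by
      have := Real.log_le_sub_one_of_pos (show 0 < 1 + Real.exp v by positivity)
      linarith
    calc _ ≤ Real.exp v * Real.exp (-v / 2) := by gcongr
      _ = 1 * Real.exp (- -v / 2) := by rw [← Real.exp_add, one_mul]; ring_nf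
      _ ≤ _ := by gcongr; linarith

lemma int_exp_abs : Integrable (fun v : ℝ => Real.exp (-|v| / 4)) := by
  rw [← integrableOn_univ, ← Set.Iic_union_Ioi (a := (0 : ℝ)), integrableOn_union]
  constructor
  · refine (integrableOn_exp_mul_Iic (a := 1 / 4) (by norm_num) 0).congr_fun ?_ measurableSet_Iic
    intro x hx
    have hx : x ≤ 0 := hx
    simp only [abs_of_nonpos hx]; ring_nf
  · refine (integrableOn_exp_mul_Ioi (a := -1 / 4) (by norm_num) 0).congr_fun ?_ measurableSet_Ioi
    intro x hx
    have hx : 0 < x := hx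
    simp only [abs_of_pos hx]; ring_nf

lemma int_master (f : ℝ → ℝ) (hf : Continuous f) (C : ℝ)
    (hC : ∀ v, |f v| ≤ C * ((1 + |v|) ^ 3 * Real.exp (-|v| / 2))) : Integrable f := by
  have hC0 : 0 ≤ C := by
    have := (abs_nonneg _).trans (hC 0)
    simpa using this
  refine Integrable.mono' (int_exp_abs.const_mul (C * (384 * Real.exp (1 / 4))))
    hf.aestronglyMeasurable (Eventually.of_forall fun v => ?_)
  rw [Real.norm_eq_abs]
  refine (hC v).trans ?_
  rw [mul_assoc]
  refine mul_le_mul_of_nonneg_left ?_ hC0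
  have h := Real.pow_div_factorial_le_exp ((1 + |v|) / 4) (by positivity) 3
  have h3 : ((Nat.factorial 3 : ℕ) : ℝ) = 6 := by norm_num [Nat.factorial]
  rw [h3] at h
  have h' : (1 + |v|) ^ 3 ≤ 384 * Real.exp ((1 + |v|) / 4) := by
    have : ((1 + |v|) / 4) ^ 3 / 6 = (1 + |v|) ^ 3 / 384 := by ring
    rw [this] at h; linarith
  calc _ ≤ 384 * Real.exp ((1 + |v|) / 4) * Real.exp (-|v| / 2) := by gcongr
    _ = _ := by
      rw [mul_assoc, mul_assoc, ← Real.exp_add, ← Real.exp_add]; ring_nf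

lemma one_le_one_add_abs (v : ℝ) : 1 ≤ 1 + |v| := by linarith [abs_nonneg v]

lemma int_g_poly (p : ℝ → ℝ) (hp : Continuous p) (C : ℝ)
    (hC : ∀ v, |p v| ≤ C * (1 + |v|) ^ 2) : Integrable (fun v => gI v * p v) := by
  refine int_master _ (gI_cont.mul hp) C fun v => ?_
  rw [abs_mul, abs_of_nonneg (gI_nonneg v)]
  calc _ ≤ ((1 + |v|) * Real.exp (-|v| / 2)) * (C * (1 + |v|) ^ 2) :=
        mul_le_mul (gI_le v) (hC v) (abs_nonneg _) (by positivity)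
    _ = _ := by ring

lemma int_k_poly (p : ℝ → ℝ) (hp : Continuous p) (C : ℝ)
    (hC : ∀ v, |p v| ≤ C * (1 + |v|) ^ 2) : Integrable (fun v => kI v * p v) := by
  have hC0 : 0 ≤ C := by
    have := (abs_nonneg _).trans (hC 0)
    simpa using this
  refine int_master _ (kI_cont.mul hp) C fun v => ?_
  rw [abs_mul, abs_of_nonneg (kI_nonneg v)]
  have := one_le_one_add_abs v
  calc _ ≤ (Real.exp (-|v| / 2)) * (C * (1 + |v|) ^ 2) :=
        mul_le_mul (kI_le v) (hC v) (abs_nonneg _) (by positivity)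
    _ ≤ (Real.exp (-|v| / 2)) * (C * (1 + |v|) ^ 3) := by
        gcongr
        · norm_num
    _ = _ := by ring

lemma sq_bd (a b c v : ℝ) (ha : 0 ≤ a) (hb : 0 ≤ b) (hc : 0 ≤ c) :
    |a * v ^ 2 + b * v + c| ≤ (a + b + c) * (1 + |v|) ^ 2 := by
  have h0 := abs_nonneg v
  have h1 : |a * v ^ 2 + b * v + c| ≤ a * |v| ^ 2 + b * |v| + c := by
    refine (abs_add_le _ _).trans ?_
    refine add_le_add ((abs_add_le _ _).trans ?_) (abs_of_nonneg hc).le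
    rw [abs_mul, abs_mul, abs_of_nonneg ha, abs_of_nonneg hb, abs_pow]
  refine h1.trans ?_
  have h2 : |v| ^ 2 ≤ (1 + |v|) ^ 2 := by nlinarith
  have h3 : |v| ≤ (1 + |v|) ^ 2 := by nlinarith
  have h4 : 1 ≤ (1 + |v|) ^ 2 := by nlinarith
  nlinarith [mul_le_mul_of_nonneg_left h2 ha, mul_le_mul_of_nonneg_left h3 hb,
    mul_le_mul_of_nonneg_left h4 hc]

lemma int_g_quad (a b c : ℝ) (ha : 0 ≤ a) (hb : 0 ≤ b) (hc : 0 ≤ c) :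
    Integrable (fun v => gI v * (a * v ^ 2 + b * v + c)) :=
  int_g_poly _ (by fun_prop) (a + b + c) fun v => sq_bd a b c v ha hb hc

lemma int_k_quad (a b c : ℝ) (ha : 0 ≤ a) (hb : 0 ≤ b) (hc : 0 ≤ c) :
    Integrable (fun v => kI v * (a * v ^ 2 + b * v + c)) :=
  int_k_poly _ (by fun_prop) (a + b + c) fun v => sq_bd a b c v ha hb hc

lemma int_g : Integrable gI := by
  simpa using int_g_quad 0 0 1 le_rfl le_rfl zero_le_one

lemma int_g2 : Integrable (fun v => gI v * v ^ 2) := by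
  simpa using int_g_quad 1 0 0 zero_le_one le_rfl le_rfl

lemma int_k : Integrable kI := by
  simpa using int_k_quad 0 0 1 le_rfl le_rfl zero_le_one

lemma int_k1 : Integrable (fun v => kI v * v) := by
  simpa using int_k_quad 0 1 0 le_rfl zero_le_one le_rfl

lemma int_k2 : Integrable (fun v => kI v * v ^ 2) := by
  simpa using int_k_quad 1 0 0 zero_le_one le_rfl le_rfl

lemma gI_deriv (v : ℝ) : HasDerivAt gI (kI v - gI v / 2) v := by
  have h1 : HasDerivAt (fun v : ℝ => Real.log (1 + Real.exp v))
      (Real.exp v / (1 + Real.exp v)) v :=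
    ((Real.hasDerivAt_exp v).const_add 1).log (by positivity)
  have h2 : HasDerivAt (fun v : ℝ => Real.exp (-v / 2)) (Real.exp (-v / 2) * (-1 / 2)) v :=
    (((hasDerivAt_id v).neg).div_const 2).exp
  have h := h1.mul h2
  have e : kI v - gI v / 2 = Real.exp v / (1 + Real.exp v) * Real.exp (-v / 2)
      + Real.log (1 + Real.exp v) * (Real.exp (-v / 2) * (-1 / 2)) := by
    unfold kI gI
    have : Real.exp (v / 2) = Real.exp v * Real.exp (-v / 2) := by
      rw [← Real.exp_add]; ring_nf
    rw [this]; ring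
  rw [e]
  exact h

lemma integral_k : ∫ v, kI v = Real.pi := by
  have hd : ∀ v : ℝ, HasDerivAt (fun v => 2 * Real.arctan (Real.exp (v / 2))) (kI v) v := by
    intro v
    have h2 : HasDerivAt (fun v : ℝ => Real.exp (v / 2)) (Real.exp (v / 2) * (1 / 2)) v :=
      ((hasDerivAt_id v).div_const 2).exp
    have h := (h2.arctan).const_mul 2
    have e : kI v = 2 * (1 / (1 + Real.exp (v / 2) ^ 2) * (Real.exp (v / 2) * (1 / 2))) := by
      have : Real.exp (v / 2) ^ 2 = Real.exp v := by
        rw [← Real.exp_nat_mul]; congr 1; push_cast; ring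
      unfold kI
      rw [this]; ring
    rw [e]; exact h
  have hb : Tendsto (fun v : ℝ => 2 * Real.arctan (Real.exp (v / 2))) atBot (nhds (2 * 0)) := by
    refine Tendsto.const_mul 2 ?_
    have h1 : Tendsto (fun v : ℝ => Real.exp (v / 2)) atBot (nhds 0) :=
      Real.tendsto_exp_atBot.comp (tendsto_id.atBot_div_const (by norm_num))
    have := (Real.continuous_arctan.tendsto 0).comp h1
    rw [Real.arctan_zero] at this
    exact this
  have ht : Tendsto (fun v : ℝ => 2 * Real.arctan (Real.exp (v / 2))) atTop
      (nhds (2 * (Real.pi / 2))) := by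
    refine Tendsto.const_mul 2 ?_
    have h1 : Tendsto (fun v : ℝ => Real.exp (v / 2)) atTop atTop :=
      Real.tendsto_exp_atTop.comp (tendsto_id.atTop_div_const (by norm_num))
    exact (tendsto_nhds_of_tendsto_nhdsWithin Real.tendsto_arctan_atTop).comp h1
  rw [integral_of_hasDerivAt_of_tendsto hd int_k hb ht]
  ring

lemma integral_k1 : ∫ v, kI v * v = 0 := by
  have h := integral_neg_eq_self (fun v : ℝ => kI v * v) volume
  have e : (fun v : ℝ => kI (-v) * (-v)) = fun v => -(kI v * v) := by
    funext v; rw [kI_neg]; ring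
  rw [e, integral_neg] at h
  linarith

lemma integral_g : ∫ v, gI v = 2 * Real.pi := by
  have h := integral_eq_zero_of_hasDerivAt_of_integrable gI_deriv
    (int_k.sub (int_g.div_const 2)) int_g
  rw [integral_sub int_k (int_g.div_const 2), integral_k, integral_div] at h
  linarith

lemma integral_g2_eq : ∫ v, gI v * v ^ 2 = 2 * (∫ v, kI v * v ^ 2) + 16 * Real.pi := by
  have hd : ∀ v : ℝ, HasDerivAt (fun v => gI v * (2 * v ^ 2 + 8 * v + 16))
      ((2 * (kI v * v ^ 2) + 8 * (kI v * v) + 16 * kI v) - gI v * v ^ 2) v := by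
    intro v
    have hp : HasDerivAt (fun v : ℝ => 2 * v ^ 2 + 8 * v + 16) (4 * v + 8) v := by
      have h := (((hasDerivAt_pow 2 v).const_mul 2).add ((hasDerivAt_id v).const_mul 8)).add_const 16
      have e : 4 * v + 8 = 2 * (((2 : ℕ) : ℝ) * v ^ (2 - 1)) + 8 * 1 := by norm_num; ring
      rw [e]; exact h
    have h := (gI_deriv v).mul hp
    have e : (2 * (kI v * v ^ 2) + 8 * (kI v * v) + 16 * kI v) - gI v * v ^ 2
        = (kI v - gI v / 2) * (2 * v ^ 2 + 8 * v + 16) + gI v * (4 * v + 8) := by ring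
    rw [e]; exact h
  have i1 := int_k2.const_mul 2
  have i2 := int_k1.const_mul 8
  have i3 := int_k.const_mul 16
  have i12 : Integrable (fun v => 2 * (kI v * v ^ 2) + 8 * (kI v * v)) := i1.add i2
  have i123 : Integrable (fun v => 2 * (kI v * v ^ 2) + 8 * (kI v * v) + 16 * kI v) := i12.add i3
  have h := integral_eq_zero_of_hasDerivAt_of_integrable hd
    (i123.sub int_g2) (int_g_quad 2 8 16 (by norm_num) (by norm_num) (by norm_num))
  rw [integral_sub i123 int_g2, integral_add i12 i3, integral_add i1 i2,
    integral_const_mul, integral_const_mul, integral_const_mul, integral_k, integral_k1] at h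
  linarith

lemma beta_partial (M : ℕ) :
    ∑ n ∈ Finset.range (2 * M), (1 : ℝ) / (n : ℝ) ^ 3 * Real.sin (Real.pi * n / 2)
      = ∑ j ∈ Finset.range M, (-1 : ℝ) ^ j / (2 * (j : ℝ) + 1) ^ 3 := by
  induction M with
  | zero => simp
  | succ M ih =>
    rw [show 2 * (M + 1) = 2 * M + 1 + 1 by ring, Finset.sum_range_succ, Finset.sum_range_succ, ih,
      Finset.sum_range_succ]
    have h1 : Real.sin (Real.pi * ((2 * M : ℕ) : ℝ) / 2) = 0 := by
      have : Real.pi * ((2 * M : ℕ) : ℝ) / 2 = M * Real.pi := by push_cast; ring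
      rw [this, Real.sin_nat_mul_pi]
    have h2 : Real.sin (Real.pi * ((2 * M + 1 : ℕ) : ℝ) / 2) = (-1) ^ M := by
      have : Real.pi * ((2 * M + 1 : ℕ) : ℝ) / 2 = M * Real.pi + Real.pi / 2 := by
        push_cast; ring
      rw [this, Real.sin_add_pi_div_two, Real.cos_nat_mul_pi]
    rw [h1, h2]
    push_cast
    ring

lemma moment_int (j : ℕ) :
    IntegrableOn (fun v : ℝ => v ^ 2 * Real.exp (-(((j : ℝ) + 1 / 2) * v))) (Set.Ioi 0) := by
  have h := integrableOn_rpow_mul_exp_neg_mul_rpow (p := 1) (s := 2) (b := (j : ℝ) + 1 / 2)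
    (by norm_num) (by norm_num) (by positivity)
  refine h.congr_fun (fun x hx => ?_) measurableSet_Ioi
  simp only [Real.rpow_one, Real.rpow_two, neg_mul]

lemma moment_val (j : ℕ) :
    ∫ v in Set.Ioi (0 : ℝ), v ^ 2 * Real.exp (-(((j : ℝ) + 1 / 2) * v))
      = 16 / (2 * (j : ℝ) + 1) ^ 3 := by
  have h := Real.integral_rpow_mul_exp_neg_mul_Ioi (a := 3) (r := (j : ℝ) + 1 / 2)
    (by norm_num) (by positivity)
  have e : (3 : ℝ) - 1 = 2 := by norm_num
  simp only [e, Real.rpow_two] at h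
  rw [h]
  have hG : Real.Gamma 3 = 2 := by
    have := Real.Gamma_nat_eq_factorial 2
    have e3 : ((2 : ℕ) : ℝ) + 1 = 3 := by norm_num
    rw [e3] at this
    rw [this]; norm_num [Nat.factorial]
  have h3 : (1 / ((j : ℝ) + 1 / 2)) ^ (3 : ℝ) = (1 / ((j : ℝ) + 1 / 2)) ^ 3 := by
    exact_mod_cast Real.rpow_natCast (1 / ((j : ℝ) + 1 / 2)) 3
  rw [hG, h3]
  have : (2 * (j : ℝ) + 1) ≠ 0 := by positivity
  have h4 : (j : ℝ) + 1 / 2 = (2 * (j : ℝ) + 1) / 2 := by ring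
  rw [h4]
  field_simp
  norm_num

lemma kI_bd (N : ℕ) (v : ℝ) :
    kI v * v ^ 2 ≤ ∑ j ∈ Finset.range (2 * N + 1),
      (-1 : ℝ) ^ j * (v ^ 2 * Real.exp (-(((j : ℝ) + 1 / 2) * v))) := by
  have e : ∀ j : ℕ, (-1 : ℝ) ^ j * (v ^ 2 * Real.exp (-(((j : ℝ) + 1 / 2) * v)))
      = (v ^ 2 * Real.exp (-v / 2)) * (-Real.exp (-v)) ^ j := by
    intro j
    rw [neg_pow (Real.exp (-v)), ← Real.exp_nat_mul]
    have : Real.exp (-(((j : ℝ) + 1 / 2) * v)) = Real.exp (-v / 2) * Real.exp (j * -v) := by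
      rw [← Real.exp_add]; ring_nf
    rw [this]; ring
  simp_rw [e]
  rw [← Finset.mul_sum]
  have hg := mul_neg_geom_sum (-Real.exp (-v)) (2 * N + 1)
  have hpow : (-Real.exp (-v)) ^ (2 * N + 1) = - Real.exp (-v) ^ (2 * N + 1) :=
    Odd.neg_pow ⟨N, rfl⟩ _
  rw [hpow] at hg
  have hk : kI v = Real.exp (-v / 2) / (1 + Real.exp (-v)) := by
    rw [← kI_neg]; rfl
  have hpos : 0 < 1 + Real.exp (-v) := by positivity
  have hs : 1 / (1 + Real.exp (-v)) ≤ ∑ j ∈ Finset.range (2 * N + 1), (-Real.exp (-v)) ^ j := by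
    rw [div_le_iff₀ hpos]
    have : 0 ≤ Real.exp (-v) ^ (2 * N + 1) := by positivity
    linarith
  calc kI v * v ^ 2 = (v ^ 2 * Real.exp (-v / 2)) * (1 / (1 + Real.exp (-v))) := by
        rw [hk]; ring
    _ ≤ _ := mul_le_mul_of_nonneg_left hs (by positivity)

lemma integral_k2_le : ∫ v, kI v * v ^ 2 ≤ Real.pi ^ 3 := by
  have habs : ∫ v, kI v * v ^ 2 = 2 * ∫ v in Set.Ioi (0 : ℝ), kI v * v ^ 2 := by
    rw [← integral_comp_abs (f := fun v => kI v * v ^ 2)]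
    congr 1
    funext v
    rcases le_total 0 v with h | h
    · rw [abs_of_nonneg h]
    · rw [abs_of_nonpos h, kI_neg]; ring
  have hN : ∀ N : ℕ, ∫ v in Set.Ioi (0 : ℝ), kI v * v ^ 2
      ≤ 16 * ∑ n ∈ Finset.range (2 * (2 * N + 1)),
        (1 : ℝ) / (n : ℝ) ^ 3 * Real.sin (Real.pi * n / 2) := by
    intro N
    rw [beta_partial]
    have hi : ∀ j ∈ Finset.range (2 * N + 1), Integrable (fun v : ℝ =>
        (-1 : ℝ) ^ j * (v ^ 2 * Real.exp (-(((j : ℝ) + 1 / 2) * v))))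
        (volume.restrict (Set.Ioi 0)) := fun j _ => (moment_int j).const_mul _
    calc _ ≤ ∫ v in Set.Ioi (0 : ℝ), ∑ j ∈ Finset.range (2 * N + 1),
          (-1 : ℝ) ^ j * (v ^ 2 * Real.exp (-(((j : ℝ) + 1 / 2) * v))) :=
          integral_mono int_k2.integrableOn (integrable_finsetSum _ hi) (fun v => kI_bd N v)
      _ = _ := by
          rw [integral_finsetSum _ hi, Finset.mul_sum]
          refine Finset.sum_congr rfl fun j _ => ?_
          rw [integral_const_mul, moment_val]; ring
  have hlim : Tendsto (fun N : ℕ => 16 * ∑ n ∈ Finset.range (2 * (2 * N + 1)),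
        (1 : ℝ) / (n : ℝ) ^ 3 * Real.sin (Real.pi * n / 2)) atTop
        (nhds (16 * (Real.pi ^ 3 / 32))) := by
    refine Tendsto.const_mul 16 ?_
    refine (hasSum_L_function_mod_four_eval_three.tendsto_sum_nat).comp
      (tendsto_atTop_mono (fun N => ?_) tendsto_id)
    simp only [id]; lia
  have := ge_of_tendsto' hlim hN
  rw [habs]
  linarith

lemma integral_g2_le : ∫ v, gI v * v ^ 2 ≤ 2 * Real.pi * (Real.pi ^ 2 + 8) := by
  rw [integral_g2_eq]
  nlinarith [integral_k2_le]

/-- the weighted integral -/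
noncomputable def JI (c S : ℝ) : ℝ := ∫ v, gI v * Real.exp (-(v - c) ^ 2 / (4 * S))

lemma int_J (c S : ℝ) (hS : 0 < S) :
    Integrable (fun v => gI v * Real.exp (-(v - c) ^ 2 / (4 * S))) := by
  refine Integrable.mono' int_g ?_ (Eventually.of_forall fun v => ?_)
  · exact (gI_cont.mul (by fun_prop)).aestronglyMeasurable
  · rw [Real.norm_eq_abs, abs_of_nonneg (mul_nonneg (gI_nonneg v) (Real.exp_pos _).le)]
    refine mul_le_of_le_one_right (gI_nonneg v) (Real.exp_le_one_iff.2 ?_)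
    rw [neg_div]
    have : 0 ≤ (v - c) ^ 2 / (4 * S) := by positivity
    linarith

lemma JI_le (c S : ℝ) (hS : 0 < S) : JI c S ≤ 2 * Real.pi := by
  rw [← integral_g]
  refine integral_mono (int_J c S hS) int_g fun v => ?_
  refine mul_le_of_le_one_right (gI_nonneg v) (Real.exp_le_one_iff.2 ?_)
  rw [neg_div]
  have : 0 ≤ (v - c) ^ 2 / (4 * S) := by positivity
  linarith

lemma JI_sum_ge (c S : ℝ) (hS : 0 < S) :
    4 * Real.pi - Real.pi * (Real.pi ^ 2 + 8 + c ^ 2) / S ≤ JI c S + JI (-c) S := by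
  unfold JI
  rw [← integral_add (int_J c S hS) (int_J (-c) S hS)]
  have i1 := int_g.mul_const (2 - c ^ 2 / (2 * S))
  have i2 := int_g2.mul_const (1 / (2 * S))
  have h : ∫ v, (gI v * (2 - c ^ 2 / (2 * S)) - gI v * v ^ 2 * (1 / (2 * S)))
      ≤ ∫ v, (gI v * Real.exp (-(v - c) ^ 2 / (4 * S))
        + gI v * Real.exp (-(v - -c) ^ 2 / (4 * S))) := by
    refine integral_mono (i1.sub i2) ((int_J c S hS).add (int_J (-c) S hS)) fun v => ?_
    have h1 := Real.add_one_le_exp (-(v - c) ^ 2 / (4 * S))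
    have h2 := Real.add_one_le_exp (-(v - -c) ^ 2 / (4 * S))
    have e : (2 - c ^ 2 / (2 * S)) - v ^ 2 * (1 / (2 * S))
        = (-(v - c) ^ 2 / (4 * S) + 1) + (-(v - -c) ^ 2 / (4 * S) + 1) := by
      field_simp; ring
    calc gI v * (2 - c ^ 2 / (2 * S)) - gI v * v ^ 2 * (1 / (2 * S))
        = gI v * ((2 - c ^ 2 / (2 * S)) - v ^ 2 * (1 / (2 * S))) := by ring
      _ ≤ gI v * (Real.exp (-(v - c) ^ 2 / (4 * S)) + Real.exp (-(v - -c) ^ 2 / (4 * S))) := by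
          refine mul_le_mul_of_nonneg_left ?_ (gI_nonneg v)
          rw [e]; exact add_le_add h1 h2
      _ = _ := by ring
  refine le_trans ?_ h
  rw [integral_sub i1 i2, integral_mul_const, integral_mul_const, integral_g]
  have h3 : (∫ v, gI v * v ^ 2) * (1 / (2 * S))
      ≤ 2 * Real.pi * (Real.pi ^ 2 + 8) * (1 / (2 * S)) :=
    mul_le_mul_of_nonneg_right integral_g2_le (by positivity)
  have e : 4 * Real.pi - Real.pi * (Real.pi ^ 2 + 8 + c ^ 2) / S
      = 2 * Real.pi * (2 - c ^ 2 / (2 * S)) - 2 * Real.pi * (Real.pi ^ 2 + 8) * (1 / (2 * S)) := by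
    field_simp; ring
  rw [e]; linarith

lemma gauss_eq (c S : ℝ) (hS : 0 < S) :
    ∫ w, Real.logb 2 (1 + Real.exp c * Real.exp (w - S)) ∂(gaussianReal 0 (2 * S).toNNReal)
      = (Real.exp (c / 2) * Real.exp (-S / 4) / (2 * Real.sqrt Real.pi * Real.sqrt S * Real.log 2))
        * JI c S := by
  have hv : (2 * S).toNNReal ≠ 0 := by
    simp only [ne_eq, Real.toNNReal_eq_zero, not_le]; linarith
  rw [integral_gaussianReal_eq_integral_smul hv,
    ← integral_add_right_eq_self _ (S - c), JI, ← integral_const_mul]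
  congr 1
  funext v
  simp only [gaussianPDFReal, smul_eq_mul, Real.coe_toNNReal (2 * S) (by linarith), Real.logb, gI]
  have e1 : Real.exp c * Real.exp (v + (S - c) - S) = Real.exp v := by
    rw [← Real.exp_add]; ring_nf
  have e2 : Real.sqrt (2 * Real.pi * (2 * S)) = 2 * Real.sqrt Real.pi * Real.sqrt S := by
    rw [show 2 * Real.pi * (2 * S) = 2 ^ 2 * (Real.pi * S) by ring, Real.sqrt_mul (by norm_num),
      Real.sqrt_sq (by norm_num), Real.sqrt_mul Real.pi_pos.le]
    ring
  have e3 : Real.exp (-(v + (S - c) - 0) ^ 2 / (2 * (2 * S)))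
      = Real.exp (c / 2) * Real.exp (-S / 4) * Real.exp (-v / 2)
        * Real.exp (-(v - c) ^ 2 / (4 * S)) := by
    rw [← Real.exp_add, ← Real.exp_add, ← Real.exp_add]
    congr 1
    field_simp
    ring
  rw [e1, e2, e3]
  ring

lemma Itilde_eq (α : ℝ) (hα : α ∈ Set.Ioo (0 : ℝ) 1) (S : ℝ) (hS : 0 < S) :
    Itilde α S = binEnt α - (Real.sqrt (Real.pi * α * (1 - α)) * Real.exp (-S / 4)
        / (2 * Real.pi * Real.sqrt S * Real.log 2))
      * (JI (Real.log (α / (1 - α))) S + JI (-Real.log (α / (1 - α))) S) := by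
  obtain ⟨h0, h1⟩ := hα
  have hb : 0 < 1 - α := by linarith
  set c := Real.log (α / (1 - α)) with hc
  have E1 : Real.exp c = α / (1 - α) := Real.exp_log (by positivity)
  have E2 : Real.exp (-c) = (1 - α) / α := by rw [Real.exp_neg, E1, inv_div]
  have hp := Real.pi_pos
  have sp : Real.sqrt Real.pi * Real.sqrt Real.pi = Real.pi := Real.mul_self_sqrt hp.le
  have sa : Real.sqrt α * Real.sqrt α = α := Real.mul_self_sqrt h0.le
  have sb : Real.sqrt (1 - α) * Real.sqrt (1 - α) = 1 - α := Real.mul_self_sqrt hb.le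
  have pp : 0 < Real.sqrt Real.pi := Real.sqrt_pos.2 hp
  have pa : 0 < Real.sqrt α := Real.sqrt_pos.2 h0
  have pb : 0 < Real.sqrt (1 - α) := Real.sqrt_pos.2 hb
  have F1 : Real.exp (c / 2) = Real.sqrt α / Real.sqrt (1 - α) := by
    rw [← Real.sqrt_div h0.le, ← E1, Real.exp_half]
  have F2 : Real.exp (-c / 2) = Real.sqrt (1 - α) / Real.sqrt α := by
    rw [← Real.sqrt_div hb.le, ← E2, Real.exp_half]
  have hs : Real.sqrt (Real.pi * α * (1 - α))
      = Real.sqrt Real.pi * Real.sqrt α * Real.sqrt (1 - α) := by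
    rw [Real.sqrt_mul (by positivity), Real.sqrt_mul hp.le]
  have G1 : (1 - α) * (Real.sqrt α / Real.sqrt (1 - α)) = Real.sqrt α * Real.sqrt (1 - α) := by
    field_simp; linarith
  have G2 : α * (Real.sqrt (1 - α) / Real.sqrt α) = Real.sqrt α * Real.sqrt (1 - α) := by
    field_simp; linarith
  have G3 : Real.sqrt Real.pi / Real.pi = 1 / Real.sqrt Real.pi := by
    field_simp; linarith
  unfold Itilde
  rw [← E1, ← E2, gauss_eq c S hS, gauss_eq (-c) S hS, F1, F2, hs]
  have : ∀ A B : ℝ, α * (Real.sqrt (1 - α) / Real.sqrt α * Real.exp (-S / 4)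
        / (2 * Real.sqrt Real.pi * Real.sqrt S * Real.log 2) * A)
      + (1 - α) * (Real.sqrt α / Real.sqrt (1 - α) * Real.exp (-S / 4)
        / (2 * Real.sqrt Real.pi * Real.sqrt S * Real.log 2) * B)
      = (Real.sqrt Real.pi * Real.sqrt α * Real.sqrt (1 - α) * Real.exp (-S / 4)
        / (2 * Real.pi * Real.sqrt S * Real.log 2)) * (B + A) := by
    intro A B
    calc _ = (α * (Real.sqrt (1 - α) / Real.sqrt α)) * (Real.exp (-S / 4)
        / (2 * Real.sqrt S * Real.log 2) * A) * (1 / Real.sqrt Real.pi)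
        + ((1 - α) * (Real.sqrt α / Real.sqrt (1 - α))) * (Real.exp (-S / 4)
        / (2 * Real.sqrt S * Real.log 2) * B) * (1 / Real.sqrt Real.pi) := by ring
      _ = _ := by rw [G1, G2, ← G3]; ring
  rw [← this]
  ring

/-- Two-sided bounds on `Ĩ(α,S)`:
`H_b(α) − (2√(παᾱ)/ln 2)·S^{−1/2}·e^{−S/4} ≤ Ĩ(α,S)
  ≤ H_b(α) − (2√(παᾱ)/ln 2)·S^{−1/2}·e^{−S/4}
      + (√(παᾱ)(π²+8+(ln(α/ᾱ))²)/(2 ln 2))·S^{−3/2}·e^{−S/4}`,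
and consequently `Ĩ(α,S) − H_b(α) ~ −(2√(παᾱ)/ln 2)·S^{−1/2}·e^{−S/4}` as `S → ∞`. -/
theorem stmt13 (α : ℝ) (hα : α ∈ Set.Ioo (0 : ℝ) 1) :
    (∀ S : ℝ, 0 < S →
      binEnt α - (2 * Real.sqrt (Real.pi * α * (1 - α)) / Real.log 2) / Real.sqrt S
          * Real.exp (-S / 4)
        ≤ Itilde α S
      ∧ Itilde α S
        ≤ binEnt α - (2 * Real.sqrt (Real.pi * α * (1 - α)) / Real.log 2) / Real.sqrt S
            * Real.exp (-S / 4)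
          + (Real.sqrt (Real.pi * α * (1 - α))
              * (Real.pi ^ 2 + 8 + (Real.log (α / (1 - α))) ^ 2) / (2 * Real.log 2))
            / S ^ ((3 : ℝ) / 2) * Real.exp (-S / 4))
    ∧ (fun S : ℝ => Itilde α S - binEnt α)
        ~[atTop] fun S : ℝ =>
          -((2 * Real.sqrt (Real.pi * α * (1 - α)) / Real.log 2) / Real.sqrt S
            * Real.exp (-S / 4)) := by
  have hl : 0 < Real.log 2 := Real.log_pos (by norm_num)
  have hp := Real.pi_pos
  have hR : 0 < Real.sqrt (Real.pi * α * (1 - α)) := by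
    obtain ⟨h0, h1⟩ := hα
    have hb : 0 < 1 - α := by linarith
    positivity
  have h32 : ∀ S : ℝ, 0 < S → S ^ ((3 : ℝ) / 2) = S * Real.sqrt S := by
    intro S hS
    rw [show (3 : ℝ) / 2 = 1 + 1 / 2 by norm_num, Real.rpow_add hS, Real.rpow_one,
      Real.sqrt_eq_rpow]
  have main : ∀ S : ℝ, 0 < S →
      binEnt α - (2 * Real.sqrt (Real.pi * α * (1 - α)) / Real.log 2) / Real.sqrt S
          * Real.exp (-S / 4)
        ≤ Itilde α S
      ∧ Itilde α S
        ≤ binEnt α - (2 * Real.sqrt (Real.pi * α * (1 - α)) / Real.log 2) / Real.sqrt S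
            * Real.exp (-S / 4)
          + (Real.sqrt (Real.pi * α * (1 - α))
              * (Real.pi ^ 2 + 8 + (Real.log (α / (1 - α))) ^ 2) / (2 * Real.log 2))
            / S ^ ((3 : ℝ) / 2) * Real.exp (-S / 4) := by
    intro S hS
    rw [Itilde_eq α hα S hS, h32 S hS]
    set c := Real.log (α / (1 - α))
    set R := Real.sqrt (Real.pi * α * (1 - α))
    have hq : 0 < Real.sqrt S := Real.sqrt_pos.2 hS
    set K := R * Real.exp (-S / 4) / (2 * Real.pi * Real.sqrt S * Real.log 2) with hK
    have hK0 : 0 ≤ K := by positivity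
    have eA : (2 * R / Real.log 2) / Real.sqrt S * Real.exp (-S / 4) = K * (4 * Real.pi) := by
      rw [hK]; field_simp; ring
    have eB : (R * (Real.pi ^ 2 + 8 + c ^ 2) / (2 * Real.log 2)) / (S * Real.sqrt S)
        * Real.exp (-S / 4) = K * (Real.pi * (Real.pi ^ 2 + 8 + c ^ 2) / S) := by
      rw [hK]; field_simp
    rw [eA, eB]
    have u := mul_le_mul_of_nonneg_left (add_le_add (JI_le c S hS) (JI_le (-c) S hS)) hK0
    have l := mul_le_mul_of_nonneg_left (JI_sum_ge c S hS) hK0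
    constructor
    · linarith
    · linarith
  refine ⟨main, ?_⟩
  rw [IsEquivalent, isLittleO_iff]
  intro ε hε
  set D := Real.pi ^ 2 + 8 + (Real.log (α / (1 - α))) ^ 2 with hD
  filter_upwards [eventually_gt_atTop 0, eventually_ge_atTop (D / (4 * ε))] with S hS hS2
  obtain ⟨h1, h2⟩ := main S hS
  rw [h32 S hS] at h2
  have hq : 0 < Real.sqrt S := Real.sqrt_pos.2 hS
  set R := Real.sqrt (Real.pi * α * (1 - α))
  set A := (2 * R / Real.log 2) / Real.sqrt S * Real.exp (-S / 4) with hA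
  have hA0 : 0 < A := by positivity
  have eB : (R * D / (2 * Real.log 2)) / (S * Real.sqrt S) * Real.exp (-S / 4)
      = D / (4 * S) * A := by
    rw [hA]; field_simp; ring
  rw [eB] at h2
  have hle : D / (4 * S) ≤ ε := by
    rw [div_le_iff₀ (by positivity)] at hS2 ⊢
    linarith
  have h3 := mul_le_mul_of_nonneg_right hle hA0.le
  simp only [Pi.sub_apply, Real.norm_eq_abs, abs_neg, abs_of_pos hA0]
  rw [abs_of_nonneg (by linarith)]
  linarith
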